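/- (Inequality (16) in the proof of Theorem 4.2) For every integer n ≥ 3 and every 0 ≤ k ≤ ⌊n/2⌋, D_0·I_{n−2,k}^B + D_1·I_{n−2,k−1}^B + D_2·I_{n−2,k−2}^B + D_3·I_{n−2,k−3}^B ≥ 0, where D_0 = n + 2k^2 + 2k − 1, D_1 = 4nk − 3n − 6k^2 + 2k + 3, D_2 = 2n^2 − 8nk + 9n + 6k^2 − 10k + 1, D_3 = −2n^2 + 4nk − 7n − 2k^2 + 6k − 3, with the convention I_{m,j}^B = 0 for j < 0. -/

import Mathlib

open scoped Classical

/-- `Ω_n = {±1, …, ±n}` as a subset of `ℤ`. -/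
def OmegaSet (n : ℕ) : Set ℤ := {a : ℤ | 1 ≤ |a| ∧ |a| ≤ (n : ℤ)}

/-- A signed permutation of length `n`: a bijection of `Ω_n` satisfying `w(-a) = -w(a)`,
extended by the identity outside `Ω_n`. -/
def IsSignedPerm (n : ℕ) (w : ℤ → ℤ) : Prop :=
  (∀ a : ℤ, w (-a) = -w a) ∧ Set.BijOn w (OmegaSet n) (OmegaSet n) ∧
    ∀ a : ℤ, a ∉ OmegaSet n → w a = a

/-- An involution in the hyperoctahedral group `B_n`. -/
def IsSignedInvolution (n : ℕ) (w : ℤ → ℤ) : Prop :=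
  IsSignedPerm n w ∧ ∀ a : ℤ, w (w a) = a

/-- The total order `-1 <_r -2 <_r ⋯ <_r 0 <_r 1 <_r 2 <_r ⋯` on `ℤ`. -/
def rlt (a b : ℤ) : Prop :=
  (a < 0 ∧ b < 0 ∧ b < a) ∨ (a < 0 ∧ 0 ≤ b) ∨ (0 ≤ a ∧ 0 ≤ b ∧ a < b)

/-- `des_B(w) = #{ i ∈ {0,…,n-1} : w(i) >_r w(i+1) }` (with `w(0) = 0`, which is forced by
antisymmetry). -/
noncomputable def desB (n : ℕ) (w : ℤ → ℤ) : ℕ :=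
  ((Finset.range n).filter fun i : ℕ => rlt (w ((i : ℤ) + 1)) (w (i : ℤ))).card

/-- `I_{n,k}^B`, the number of involutions `w` in `B_n` with `des_B(w) = k`. -/
noncomputable def InkB (n k : ℕ) : ℕ :=
  {w : ℤ → ℤ | IsSignedInvolution n w ∧ desB n w = k}.ncard

/-- `I_{n,k}^B` extended by `0` for negative `k`, as an integer. -/
noncomputable def IZ (n : ℕ) (k : ℤ) : ℤ :=
  if 0 ≤ k then (InkB n k.toNat : ℤ) else 0

section

open Finset

theorem eq_of_monotone_of_card_fiber_eq {n : ℕ} {α : Type*} [LinearOrder α] {f g : Fin n → α}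
    (hf : Monotone f) (hg : Monotone g)
    (h : ∀ a, #{x | f x = a} = #{x | g x = a}) : f = g := by
  have e : ∀ a, {x // f x = a} ≃ {x // g x = a} := fun a =>
    Fintype.equivOfCardEq (by rw [Fintype.card_subtype, Fintype.card_subtype, h])
  have hσ : g ∘ Equiv.ofFiberEquiv e = f := funext fun x => Equiv.ofFiberEquiv_map e x
  have := Tuple.unique_monotone (f := g) (σ := Equiv.ofFiberEquiv e) (τ := 1)
    (by rwa [hσ]) (by simpa using hg)
  rw [hσ] at this
  simpa using this

theorem eq_id_of_strictMono_on_fibers {n : ℕ} {α : Type*} [LinearOrder α] {f : Fin n → α}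
    (hf : Monotone f) {u : Fin n → Fin n} (hfu : ∀ x, f (u x) = f x)
    (hu : ∀ x y, x < y → f x = f y → u x < u y) : u = id := by
  have hs : StrictMono u := fun x y hxy => by
    rcases (hf hxy.le).eq_or_lt with h | h
    · exact hu x y hxy h
    · exact hf.reflect_lt (by rwa [hfu, hfu])
  refine (hs.range_inj strictMono_id).1 ?_
  simp [(Finite.injective_iff_surjective.1 hs.injective).range_eq]

/-- A weakly increasing labelling `p.1` together with an involution `p.2` that is increasing on
each level set of the labelling. -/
def IsLabelledInvolution {n m : ℕ} (p : (Fin n → Fin m) × (Fin n → Fin n)) : Prop :=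
  Monotone p.1 ∧ (∀ x, p.2 (p.2 x) = x) ∧ ∀ x y, x < y → p.1 x = p.1 y → p.2 x < p.2 y

/-- The pair of labels of a point and of its partner, in lexicographic order. -/
def labelPair {n m : ℕ} (p : (Fin n → Fin m) × (Fin n → Fin n)) (x : Fin n) :
    Fin m ×ₗ Fin m := toLex (p.1 x, p.1 (p.2 x))

/-- The matrix counting the points with a given pair of labels. -/
def labelMatrix {n m : ℕ} (p : (Fin n → Fin m) × (Fin n → Fin n)) (a : Fin m × Fin m) : ℕ :=
  #{x | labelPair p x = toLex a}

theorem IsLabelledInvolution.monotone_labelPair {n m : ℕ}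
    {p : (Fin n → Fin m) × (Fin n → Fin n)} (hp : IsLabelledInvolution p) :
    Monotone (labelPair p) := by
  intro x y hxy
  rcases hxy.eq_or_lt with rfl | h
  · rfl
  rw [labelPair, labelPair, Prod.Lex.toLex_le_toLex]
  rcases (hp.1 hxy).lt_or_eq with h' | h'
  · exact Or.inl h'
  · exact Or.inr ⟨h', hp.1 (hp.2.2 x y h h').le⟩

theorem labelPair_eq_iff {n m : ℕ} {p : (Fin n → Fin m) × (Fin n → Fin n)} {x : Fin n}
    {a : Fin m × Fin m} : labelPair p x = toLex a ↔ p.1 x = a.1 ∧ p.1 (p.2 x) = a.2 := by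
  rw [labelPair, toLex_inj, Prod.ext_iff]

theorem IsLabelledInvolution.eq_of_labelMatrix_eq {n m : ℕ}
    {p q : (Fin n → Fin m) × (Fin n → Fin n)} (hp : IsLabelledInvolution p)
    (hq : IsLabelledInvolution q) (h : labelMatrix p = labelMatrix q) : p = q := by
  have hL : labelPair p = labelPair q :=
    eq_of_monotone_of_card_fiber_eq hp.monotone_labelPair hq.monotone_labelPair
      fun a => congrFun h (ofLex a)
  have h12 : ∀ x, p.1 x = q.1 x ∧ p.1 (p.2 x) = q.1 (q.2 x) := fun x => by
    have := congrFun hL x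
    rwa [labelPair, labelPair, toLex_inj, Prod.ext_iff] at this
  have h1 : p.1 = q.1 := funext fun x => (h12 x).1
  have hid : q.2 ∘ p.2 = id := by
    refine eq_id_of_strictMono_on_fibers hp.monotone_labelPair (fun x => ?_) fun x y hxy hf => ?_
    · refine labelPair_eq_iff.2 ?_
      simp only [Function.comp]
      have e1 := (h12 (p.2 x)).2
      have e2 := (h12 (q.2 (p.2 x))).2
      rw [hp.2.1] at e1
      rw [hq.2.1, ← h1] at e2
      exact ⟨by rw [e1, h1], e2⟩
    · replace hf := labelPair_eq_iff.1 hf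
      exact hq.2.2 _ _ (hp.2.2 x y hxy hf.1) (by rw [← h1]; exact hf.2)
  refine Prod.ext h1 (funext fun x => ?_)
  have := congrFun hid x
  simp only [Function.comp, id] at this
  rw [← hq.2.1 (p.2 x), this]

theorem exists_labelledInvolution {n m : ℕ} {M : Fin m × Fin m → ℕ}
    (hsum : ∑ a, M a = n) (hM : ∀ a, M a.swap = M a) :
    ∃ p : (Fin n → Fin m) × (Fin n → Fin n), IsLabelledInvolution p ∧ labelMatrix p = M := by
  have hcard : Fintype.card (Σ a : Fin m × Fin m, Fin (M a)) = n := by simp [hsum]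
  let e := Fintype.equivFinOfCardEq hcard
  let f : Fin n → Fin m ×ₗ Fin m := fun x => toLex (e.symm x).1
  have hf : ∀ a, #{x | f x = toLex a} = M a := by
    intro a
    rw [← Fintype.card_subtype, ← Fintype.card_fin (M a)]
    exact Fintype.card_congr ((e.symm.subtypeEquiv (q := fun s => s.1 = a) (by simp [f])).trans
      (Equiv.sigmaSubtype a))
  have card_comp (g : Fin n → Fin m ×ₗ Fin m) (σ : Equiv.Perm (Fin n)) (a) :
      #{x | g (σ x) = a} = #{x | g x = a} := by
    rw [← Fintype.card_subtype, ← Fintype.card_subtype]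
    exact Fintype.card_congr (σ.subtypeEquiv (by simp))
  let L := f ∘ Tuple.sort f
  have hLmono : Monotone L := Tuple.monotone_sort f
  have hL : ∀ a, #{x | L x = toLex a} = M a := fun a => (card_comp f _ _).trans (hf a)
  let L' : Fin n → Fin m ×ₗ Fin m := fun x => toLex (ofLex (L x)).swap
  let τ := Tuple.sort L'
  obtain ⟨hτmono, hτ⟩ := Tuple.eq_sort_iff.1 (show τ = Tuple.sort L' from rfl)
  have hLτ : L' ∘ τ = L := by
    refine eq_of_monotone_of_card_fiber_eq hτmono hLmono fun a => ?_
    refine (card_comp L' τ a).trans ?_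
    have h1 := hL (ofLex a)
    have h2 := hL (ofLex a).swap
    rw [hM] at h2
    rw [toLex_ofLex] at h1
    rw [h1, ← h2]
    congr 1
    ext x
    simp only [mem_filter, mem_univ, true_and, L']
    rw [← ofLex_inj, ofLex_toLex, ← ofLex_inj (b := toLex _), ofLex_toLex, Prod.swap_eq_iff_eq_swap]
  have hLτ' : ∀ x, L (τ x) = toLex (ofLex (L x)).swap := fun x => by
    have h := congrFun hLτ x
    simp only [Function.comp, L'] at h
    rw [← h, ofLex_toLex, Prod.swap_swap, toLex_ofLex]
  have hτlt : ∀ x y, x < y → L x = L y → τ x < τ y := fun x y hxy h => by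
    refine hτ x y hxy ?_
    have := congrFun hLτ
    simp only [Function.comp] at this
    rw [this, this, h]
  have hτinv : τ ∘ τ = id := by
    refine eq_id_of_strictMono_on_fibers hLmono (fun x => ?_) fun x y hxy h => ?_
    · simp [hLτ']
    · refine hτlt _ _ (hτlt x y hxy h) ?_
      rw [hLτ', hLτ', h]
  have hfst : Monotone fun x => (ofLex (L x)).1 := fun x y hxy =>
    Prod.Lex.monotone_fst _ _ (hLmono hxy)
  refine ⟨(fun x => (ofLex (L x)).1, τ), ⟨hfst, fun x => congrFun hτinv x, fun x y hxy h => ?_⟩, ?_⟩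
  · rcases (hLmono hxy.le).eq_or_lt with h' | h'
    · exact hτlt x y hxy h'
    · have := Prod.Lex.lt_iff.1 h'
      refine hfst.reflect_lt ?_
      simp only [hLτ', ofLex_toLex, Prod.fst_swap]
      rcases this with h1 | h1
      · exact absurd h h1.ne
      · exact h1.2
  · funext a
    rw [← hL a, labelMatrix]
    congr 1
    ext x
    simp [labelPair, hLτ']

theorem card_labelledInvolution (n m : ℕ) (S : Fin m → Fin m → Prop) :
    #{p : (Fin n → Fin m) × (Fin n → Fin n) |
        IsLabelledInvolution p ∧ ∀ x, S (p.1 x) (p.1 (p.2 x))} =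
      #{M ∈ piAntidiag (univ : Finset (Fin m × Fin m)) n |
        (∀ a, M a.swap = M a) ∧ ∀ a, M a ≠ 0 → S a.1 a.2} := by
  refine card_bij (fun p _ => labelMatrix p) ?_ ?_ ?_
  · simp only [mem_filter, mem_univ, true_and, mem_piAntidiag, implies_true, and_true, and_imp]
    intro p hp hS
    refine ⟨?_, fun a => ?_, fun a ha => ?_⟩
    · have := card_eq_sum_card_fiberwise (f := fun x => ofLex (labelPair p x)) (s := univ)
        (t := univ) (by simp)
      rw [card_univ, Fintype.card_fin] at this
      exact this.symm
    · refine card_nbij' p.2 p.2 ?_ ?_ ?_ ?_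
      · intro x hx
        simp only [coe_filter, mem_univ, true_and, Set.mem_ofPred_eq, labelPair_eq_iff] at hx ⊢
        rw [hp.2.1]
        exact hx.symm
      · intro x hx
        simp only [coe_filter, mem_univ, true_and, Set.mem_ofPred_eq, labelPair_eq_iff] at hx ⊢
        rw [hp.2.1]
        exact hx.symm
      · exact fun x _ => hp.2.1 x
      · exact fun x _ => hp.2.1 x
    · obtain ⟨x, hx⟩ := card_ne_zero.1 ha
      simp only [mem_filter, mem_univ, true_and, labelPair_eq_iff] at hx
      rw [← hx.1, ← hx.2]
      exact hS x
  · simp only [mem_filter, mem_univ, true_and]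
    exact fun p hp q hq h => hp.1.eq_of_labelMatrix_eq hq.1 h
  · simp only [mem_filter, mem_univ, true_and, mem_piAntidiag, implies_true, and_true, and_imp]
    intro M hsum hM hS
    obtain ⟨p, hp, rfl⟩ := exists_labelledInvolution hsum hM
    refine ⟨p, ⟨hp, fun x => hS (p.1 x, p.1 (p.2 x)) (card_ne_zero.2 ⟨x, ?_⟩)⟩, rfl⟩
    simp [labelPair]

/-- The weights of the diagonal and above-diagonal entries of a symmetric matrix in the sum of all
its entries. -/
def foldMatrix {m : ℕ} (M : Fin m × Fin m → ℕ) (a : Fin m × Fin m) : ℕ :=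
  if a.1 = a.2 then M a else if a.1 < a.2 then 2 * M a else 0

theorem sum_foldMatrix {m : ℕ} {M : Fin m × Fin m → ℕ} (hM : ∀ a, M a.swap = M a) :
    ∑ a, foldMatrix M a = ∑ a, M a := by
  have h : ∑ a, (if a.2 < a.1 then M a else 0) = ∑ a, (if a.1 < a.2 then M a else 0) :=
    Fintype.sum_equiv (Equiv.prodComm _ _) _ _ fun a => by
      rw [Equiv.prodComm_apply, hM]
      rfl
  have e1 : ∑ a, foldMatrix M a = ∑ a, (if a.1 = a.2 then M a else 0) +
      (∑ a, (if a.1 < a.2 then M a else 0) + ∑ a, (if a.1 < a.2 then M a else 0)) := by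
    rw [← sum_add_distrib, ← sum_add_distrib]
    refine sum_congr rfl fun a _ => ?_
    unfold foldMatrix
    split_ifs <;> lia
  have e2 : ∑ a, M a = ∑ a, (if a.1 = a.2 then M a else 0) +
      (∑ a, (if a.1 < a.2 then M a else 0) + ∑ a, (if a.2 < a.1 then M a else 0)) := by
    rw [← sum_add_distrib, ← sum_add_distrib]
    refine sum_congr rfl fun a _ => ?_
    split_ifs <;> lia
  rw [e1, e2, h]

/-- The symmetric matrix with a given fold. -/
def unfoldMatrix {m : ℕ} (l : Fin m × Fin m → ℕ) (a : Fin m × Fin m) : ℕ :=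
  if a.1 = a.2 then l a else if a.1 < a.2 then l a / 2 else l a.swap / 2

theorem unfoldMatrix_swap {m : ℕ} (l : Fin m × Fin m → ℕ) (a : Fin m × Fin m) :
    unfoldMatrix l a.swap = unfoldMatrix l a := by
  obtain ⟨i, j⟩ := a
  rcases lt_trichotomy i j with h | rfl | h
  · simp [unfoldMatrix, h.ne, h.ne', h, h.not_gt]
  · rfl
  · simp [unfoldMatrix, h.ne, h.ne', h, h.not_gt]

theorem unfoldMatrix_foldMatrix {m : ℕ} {M : Fin m × Fin m → ℕ} (hM : ∀ a, M a.swap = M a) :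
    unfoldMatrix (foldMatrix M) = M := by
  funext ⟨i, j⟩
  have := hM (i, j)
  rcases lt_trichotomy i j with h | rfl | h
  · simp [unfoldMatrix, foldMatrix, h.ne, h]
  · simp [unfoldMatrix, foldMatrix]
  · simpa [unfoldMatrix, foldMatrix, h.ne, h.ne', h, h.not_gt] using this

theorem foldMatrix_unfoldMatrix {m : ℕ} {l : Fin m × Fin m → ℕ}
    (hl : ∀ a, l a ≠ 0 → a.1 ≤ a.2) (he : ∀ a, a.1 ≠ a.2 → Even (l a)) :
    foldMatrix (unfoldMatrix l) = l := by
  funext ⟨i, j⟩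
  rcases lt_trichotomy i j with h | rfl | h
  · simpa [unfoldMatrix, foldMatrix, h.ne, h] using Nat.two_mul_div_two_of_even (he (i, j) h.ne)
  · simp [unfoldMatrix, foldMatrix]
  · have := mt (hl (i, j)) h.not_ge
    simp only [ne_eq, not_not] at this
    simp [foldMatrix, h.ne', h.not_gt, this]

/-- The positions on or above the diagonal lying in the relation `S`. -/
noncomputable def upperPositions {m : ℕ} (S : Fin m → Fin m → Prop) : Finset (Fin m × Fin m) :=
  {a | a.1 ≤ a.2 ∧ S a.1 a.2}

theorem card_symmetric_eq {m : ℕ} (n : ℕ) {S : Fin m → Fin m → Prop}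
    (hS : ∀ i j, S i j → S j i) :
    #{M ∈ piAntidiag (univ : Finset (Fin m × Fin m)) n |
        (∀ a, M a.swap = M a) ∧ ∀ a, M a ≠ 0 → S a.1 a.2} =
      #{l ∈ finsuppAntidiag (upperPositions S) n |
        ∀ a ∈ upperPositions S, a.1 ≠ a.2 → Even (l a)} := by
  refine card_bij' (fun M _ => Finsupp.equivFunOnFinite.symm (foldMatrix M))
    (fun l _ => unfoldMatrix l) ?_ ?_ ?_ ?_
  · simp only [mem_filter, mem_piAntidiag, mem_univ, implies_true, and_true, mem_finsuppAntidiag,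
      and_imp]
    intro M hsum hM hMS
    have hsupp : (Finsupp.equivFunOnFinite.symm (foldMatrix M)).support ⊆ upperPositions S := by
      intro a ha
      simp only [Finsupp.mem_support_iff, Finsupp.equivFunOnFinite_symm_apply_apply] at ha
      have h1 : M a ≠ 0 := by
        intro h
        simp [foldMatrix, h] at ha
      simp only [upperPositions, mem_filter, mem_univ, true_and]
      refine ⟨?_, hMS a h1⟩
      by_contra h
      simp [foldMatrix, (not_le.1 h).ne', (not_le.1 h).not_gt] at ha
    refine ⟨⟨?_, hsupp⟩, fun a _ ha => ?_⟩
    · rw [← hsum, ← sum_foldMatrix hM]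
      refine sum_subset (subset_univ _) fun a _ ha => ?_
      exact Finsupp.notMem_support_iff.1 fun h => ha (hsupp h)
    · simp only [Finsupp.equivFunOnFinite_symm_apply_apply, foldMatrix, ha, if_false]
      split_ifs <;> simp
  · simp only [mem_filter, mem_piAntidiag, mem_univ, implies_true, and_true, mem_finsuppAntidiag,
      and_imp]
    intro l hsum hl he
    have hl' : ∀ a, l a ≠ 0 → a.1 ≤ a.2 ∧ S a.1 a.2 := fun a ha => by
      simpa [upperPositions] using hl (Finsupp.mem_support_iff.2 ha)
    have he' : ∀ a, a.1 ≠ a.2 → Even (l a) := fun a ha => by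
      by_cases h : a ∈ upperPositions S
      · exact he a h ha
      · rw [Finsupp.notMem_support_iff.1 fun h' => h (hl h')]
        exact Even.zero
    refine ⟨?_, unfoldMatrix_swap _, fun a ha => ?_⟩
    · rw [← sum_foldMatrix (unfoldMatrix_swap _),
        foldMatrix_unfoldMatrix (fun a ha => (hl' a ha).1) he', ← hsum]
      exact (sum_subset (subset_univ _) fun a _ ha =>
        Finsupp.notMem_support_iff.1 fun h => ha (hl h)).symm
    · unfold unfoldMatrix at ha
      split_ifs at ha with h1 h2
      · exact (hl' a ha).2
      · exact (hl' a (by lia)).2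
      · exact hS _ _ (hl' a.swap (by lia)).2
  · simp only [mem_filter, and_imp]
    intro M _ hM _
    simp [unfoldMatrix_foldMatrix hM]
  · simp only [mem_filter, mem_finsuppAntidiag, and_imp]
    intro l hsum hl he
    have hl' : ∀ a, l a ≠ 0 → a.1 ≤ a.2 ∧ S a.1 a.2 := fun a ha => by
      simpa [upperPositions] using hl (Finsupp.mem_support_iff.2 ha)
    rw [foldMatrix_unfoldMatrix (fun a ha => (hl' a ha).1) fun a ha => ?_]
    · simp
    · by_cases h : a ∈ upperPositions S
      · exact he a h ha
      · rw [Finsupp.notMem_support_iff.1 fun h' => h (hl h')]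
        exact Even.zero

open PowerSeries in
theorem mk_even_mul_one_sub_sq :
    (mk fun n => if Even n then 1 else 0 : PowerSeries ℤ) * (1 - X ^ 2) = 1 := by
  ext n
  rw [mul_sub, mul_one, map_sub, coeff_mk, coeff_mul_X_pow', coeff_mk, coeff_one]
  rcases n with _ | _ | n
  · simp
  · simp
  · simp [Nat.even_add]

open PowerSeries in
theorem exists_series_card {ι : Type*} (P : Finset ι) (D : ι → Prop) :
    ∃ F : PowerSeries ℤ, F * ((1 - X) ^ #{a ∈ P | D a} * (1 - X ^ 2) ^ #{a ∈ P | ¬ D a}) = 1 ∧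
      ∀ n, coeff n F = #{l ∈ finsuppAntidiag P n | ∀ a ∈ P, ¬ D a → Even (l a)} := by
  refine ⟨∏ a ∈ P, if D a then mk 1 else mk fun n => if Even n then 1 else 0, ?_, fun n => ?_⟩
  · rw [prod_ite, prod_const, prod_const, mul_mul_mul_comm, ← mul_pow, ← mul_pow,
      mk_one_mul_one_sub_eq_one, mk_even_mul_one_sub_sq, one_pow, one_pow, one_mul]
  · rw [coeff_prod, card_filter, Nat.cast_sum]
    refine sum_congr rfl fun l _ => ?_
    have : ∀ a, coeff (l a) (if D a then mk 1 else mk fun n => if Even n then (1 : ℤ) else 0) =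
        if ¬ D a → Even (l a) then 1 else 0 := fun a => by
      by_cases h : D a <;> simp [h]
    simp only [this, prod_ite_zero, prod_const_one]
    push_cast
    rfl

theorem card_lt_same_parity (j : ℕ) : #{i ∈ range j | i % 2 = j % 2} = j / 2 := by
  induction j using Nat.twoStepInduction with
  | zero => rfl
  | one => simp
  | more j h _ =>
    rw [range_add_one, range_add_one, filter_insert, filter_insert, Nat.add_mod_right,
      if_neg (by lia), if_pos rfl, card_insert_of_notMem (by simp), h]
    lia

theorem sum_range_half (r : ℕ) : ∑ j ∈ range (2 * r + 1), j / 2 = r ^ 2 := by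
  induction r with
  | zero => rfl
  | succ r ih =>
    rw [show 2 * (r + 1) + 1 = 2 * r + 1 + 1 + 1 by ring, sum_range_succ, sum_range_succ, ih,
      show (2 * r + 1) / 2 = r by lia, show (2 * r + 1 + 1) / 2 = r + 1 by lia]
    ring

/-- Two labels of the same parity. -/
def SameParity {m : ℕ} (i j : Fin m) : Prop := (i : ℕ) % 2 = (j : ℕ) % 2

theorem card_diag_upperPositions (r : ℕ) :
    #{a ∈ upperPositions (SameParity (m := 2 * r + 1)) | a.1 = a.2} = 2 * r + 1 := by
  have : {a ∈ upperPositions (SameParity (m := 2 * r + 1)) | a.1 = a.2} =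
      univ.map ⟨fun i => (i, i), fun i j h => (Prod.ext_iff.1 h).1⟩ := by
    ext ⟨i, j⟩
    simp only [upperPositions, mem_filter, mem_univ, true_and, mem_map]
    constructor
    · rintro ⟨_, rfl⟩
      exact ⟨i, rfl⟩
    · rintro ⟨k, hk⟩
      obtain ⟨rfl, rfl⟩ : k = i ∧ k = j := Prod.ext_iff.1 hk
      exact ⟨⟨le_rfl, rfl⟩, rfl⟩
  rw [this, card_map, card_univ, Fintype.card_fin]

theorem card_offDiag_upperPositions (r : ℕ) :
    #{a ∈ upperPositions (SameParity (m := 2 * r + 1)) | ¬ a.1 = a.2} = r ^ 2 := by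
  rw [← sum_range_half, ← Fin.sum_univ_eq_sum_range, upperPositions, filter_filter, card_filter,
    Fintype.sum_prod_type_right]
  refine sum_congr rfl fun j _ => ?_
  rw [← card_lt_same_parity, card_filter]
  have hj : (j : ℕ) ≤ 2 * r + 1 := j.is_lt.le
  have h := Fin.sum_univ_eq_sum_range
    (fun i => if (i < (j : ℕ) ∧ i % 2 = (j : ℕ) % 2) then 1 else 0) (2 * r + 1)
  have h' : ∑ i ∈ range (2 * r + 1), (if (i < (j : ℕ) ∧ i % 2 = (j : ℕ) % 2) then 1 else 0) =
      ∑ i ∈ range (j : ℕ), if i % 2 = (j : ℕ) % 2 then 1 else 0 := by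
    refine (sum_subset_zero_on_sdiff (range_mono hj) (fun i hi => ?_) fun i hi => ?_).symm
    · simp only [mem_sdiff, mem_range] at hi
      simp [hi.2]
    · simp [mem_range.1 hi]
  rw [← h', ← h]
  refine sum_congr rfl fun i _ => if_congr ?_ rfl rfl
  simp only [SameParity, Fin.ext_iff, Fin.le_def]
  lia

open PowerSeries in
theorem series_recurrence {F : PowerSeries ℤ} {a b : ℕ}
    (h : F * ((1 - X) ^ a * (1 - X ^ 2) ^ b) = 1) :
    (1 - X ^ 2) * d⁄dX ℤ F = ((a : PowerSeries ℤ) * (1 + X) + 2 * (b : PowerSeries ℤ) * X) * F := by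
  have hG : (1 - X ^ 2) * d⁄dX ℤ ((1 - X) ^ a * (1 - X ^ 2) ^ b : PowerSeries ℤ) =
      -((a : PowerSeries ℤ) * (1 + X) + 2 * (b : PowerSeries ℤ) * X) *
        ((1 - X) ^ a * (1 - X ^ 2) ^ b) := by
    rw [Derivation.leibniz, Derivation.leibniz_pow, Derivation.leibniz_pow]
    have h1 : d⁄dX ℤ (1 - X : PowerSeries ℤ) = -1 := by simp [map_sub]
    have h2 : d⁄dX ℤ (1 - X ^ 2 : PowerSeries ℤ) = -(2 * X) := by
      simp [map_sub, Derivation.leibniz_pow]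
    rw [h1, h2]
    simp only [smul_eq_mul, nsmul_eq_mul]
    rcases a with _ | a <;> rcases b with _ | b <;> simp <;> ring
  have hd := congrArg (d⁄dX ℤ) h
  rw [Derivation.leibniz] at hd
  simp only [smul_eq_mul] at hd
  have h0 : d⁄dX ℤ (1 : PowerSeries ℤ) = 0 := by simp
  try rw [h0] at hd
  linear_combination (-(1 - X ^ 2) * d⁄dX ℤ F + ((a : PowerSeries ℤ) * (1 + X) +
    2 * (b : PowerSeries ℤ) * X) * F) * h +
    (F * (1 - X ^ 2)) * hd - F * F * hG

open PowerSeries in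
theorem coeff_recurrence {F : PowerSeries ℤ} {a b : ℕ}
    (h : F * ((1 - X) ^ a * (1 - X ^ 2) ^ b) = 1) (n : ℕ) :
    ((n : ℤ) + 2) * coeff (n + 2) F =
      a * coeff (n + 1) F + (n + a + 2 * b) * coeff n F := by
  have key := congrArg (coeff (n + 1)) (series_recurrence h)
  obtain ⟨c, hc⟩ : ∃ c : ℤ, c = a + 2 * b := ⟨_, rfl⟩
  have e1 : ((1 - X ^ 2) * d⁄dX ℤ F : PowerSeries ℤ) = d⁄dX ℤ F - (d⁄dX ℤ F * X) * X := by ring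
  have e2 : ((a : PowerSeries ℤ) * (1 + X) + 2 * (b : PowerSeries ℤ) * X) * F =
      C (a : ℤ) * F + C c * (F * X) := by
    rw [hc]
    simp only [map_add, map_mul, map_natCast, map_ofNat]
    ring
  rw [e1, e2, map_sub, map_add, coeff_C_mul, coeff_C_mul, coeff_succ_mul_X, coeff_succ_mul_X,
    coeff_derivative] at key
  rcases n with _ | n
  · rw [coeff_zero_mul_X] at key
    push_cast at key ⊢
    linear_combination key + coeff 0 F * hc
  · rw [coeff_succ_mul_X, coeff_derivative] at key
    push_cast at key ⊢
    linear_combination key + coeff (n + 1) F * hc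

open PowerSeries in
theorem coeff_one_of_mul_eq_one {F : PowerSeries ℤ} {a b : ℕ}
    (h : F * ((1 - X) ^ a * (1 - X ^ 2) ^ b) = 1) :
    coeff 0 F = 1 ∧ coeff 1 F = a := by
  have h0 : coeff 0 F = 1 := by
    have := congrArg (coeff 0) h
    simpa using this
  have key := congrArg (coeff 0) (series_recurrence h)
  have e : ((a : PowerSeries ℤ) * (1 + X) + 2 * (b : PowerSeries ℤ) * X) * F =
      C (a : ℤ) * F + ((a + 2 * b : PowerSeries ℤ) * F) * X := by
    simp only [map_natCast]
    ring
  have e1 : ((1 - X ^ 2) * d⁄dX ℤ F : PowerSeries ℤ) = d⁄dX ℤ F - (d⁄dX ℤ F * X) * X := by ring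
  rw [e, e1, map_sub, map_add, coeff_zero_mul_X, coeff_zero_mul_X, coeff_C_mul, coeff_derivative,
    h0] at key
  exact ⟨h0, by simpa using key⟩

/-- Integer sequences vanishing at `0` and beyond `n`, bounded by `r`, that increase weakly on
`{0, …, n}` and strictly at the positions `i` with `d i`. -/
noncomputable def chains (d : ℕ → Prop) : ℕ → ℕ → Finset (ℕ → ℕ)
  | 0, _ => {0}
  | n + 1, r => (Icc (if d n then 1 else 0) r).biUnion fun q =>
      (chains d n (q - if d n then 1 else 0)).image fun s => Function.update s (n + 1) q

theorem mem_chains {d : ℕ → Prop} {n r : ℕ} {s : ℕ → ℕ} :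
    s ∈ chains d n r ↔ s 0 = 0 ∧ (∀ i < n, s i + (if d i then 1 else 0) ≤ s (i + 1)) ∧
      s n ≤ r ∧ ∀ i > n, s i = 0 := by
  induction n generalizing r s with
  | zero =>
    simp only [chains, mem_singleton]
    constructor
    · rintro rfl
      simp
    · rintro ⟨h0, -, -, h⟩
      funext i
      rcases i with _ | i
      · exact h0
      · exact h _ (by lia)
  | succ n ih =>
    simp only [chains, mem_biUnion, mem_Icc, mem_image, ih]
    constructor
    · rintro ⟨q, ⟨hq1, hq2⟩, t, ⟨h0, h1, h2, h3⟩, rfl⟩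
      refine ⟨by simpa using h0, fun i hi => ?_, by simpa using hq2, fun i hi => ?_⟩
      · rw [Function.update_of_ne (by lia)]
        rcases Nat.lt_succ_iff_lt_or_eq.1 hi with h | rfl
        · rw [Function.update_of_ne (by lia)]
          exact h1 i h
        · rw [Function.update_self]
          lia
      · rw [Function.update_of_ne (by lia)]
        exact h3 i (by lia)
    · rintro ⟨h0, h1, h2, h3⟩
      have hn := h1 n (by lia)
      refine ⟨s (n + 1), ⟨by lia, h2⟩, Function.update s (n + 1) 0,
        ⟨by simpa using h0, fun i hi => ?_, ?_, fun i hi => ?_⟩, by simp⟩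
      · rw [Function.update_of_ne (by lia), Function.update_of_ne (by lia)]
        exact h1 i (by lia)
      · rw [Function.update_of_ne (by lia)]
        lia
      · rcases eq_or_ne i (n + 1) with rfl | h
        · simp
        · rw [Function.update_of_ne h]
          exact h3 i (by lia)

theorem sum_range_choose_sub {n k : ℕ} (hk : k ≤ n) (R : ℕ) :
    ∑ j ∈ range R, (n + j - k).choose n = (n + R - k).choose (n + 1) := by
  induction R with
  | zero => simp [Nat.choose_eq_zero_of_lt (show n - k < n + 1 by lia)]
  | succ R ih =>
    rw [sum_range_succ, ih, show n + (R + 1) - k = n + R - k + 1 by lia, Nat.choose_succ_succ',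
      add_comm]

theorem card_chains (d : ℕ → Prop) (n r : ℕ) :
    #(chains d n r) = (n + r - #{i ∈ range n | d i}).choose n := by
  induction n generalizing r with
  | zero => simp [chains]
  | succ n ih =>
    have hk : #{i ∈ range n | d i} ≤ n := by simpa using card_filter_le (range n) d
    have hcard : #(chains d (n + 1) r) =
        ∑ q ∈ Icc (if d n then 1 else 0) r, #(chains d n (q - if d n then 1 else 0)) := by
      rw [chains, card_biUnion]
      · refine sum_congr rfl fun q _ => card_image_of_injOn fun s hs t ht h => funext fun i => ?_
        rcases eq_or_ne i (n + 1) with rfl | hi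
        · rw [(mem_chains.1 hs).2.2.2 _ (by lia), (mem_chains.1 ht).2.2.2 _ (by lia)]
        · simpa [hi] using congrFun h i
      · intro q _ q' _ hq
        refine disjoint_left.2 fun s hs hs' => hq ?_
        obtain ⟨t, -, rfl⟩ := mem_image.1 hs
        obtain ⟨t', -, h⟩ := mem_image.1 hs'
        simpa using (congrFun h (n + 1)).symm
    rw [hcard, range_add_one, filter_insert]
    simp only [ih]
    by_cases h : d n
    · simp only [h, if_true]
      rw [card_insert_of_notMem (by simp), show Icc 1 r = Ico 1 (r + 1) by ext; simp,
        sum_Ico_eq_sum_range, show n + 1 + r - (#{i ∈ range n | d i} + 1) =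
          n + r - #{i ∈ range n | d i} by lia, ← sum_range_choose_sub hk]
      simp only [Nat.add_sub_cancel, Nat.add_sub_cancel_left]
    · simp only [h, if_false, Nat.sub_zero]
      rw [← Nat.range_succ_eq_Icc_zero, sum_range_choose_sub hk]
      congr 1
      lia

theorem strictMono_fin_iff {n : ℕ} {α : Type*} [Preorder α] {f : Fin n → α} :
    StrictMono f ↔ ∀ i (h : i + 1 < n), f ⟨i, by lia⟩ < f ⟨i + 1, h⟩ := by
  rcases n with _ | n
  · exact ⟨fun _ i h => absurd h (by lia), fun _ i => i.elim0⟩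
  · rw [Fin.strictMono_iff_lt_succ]
    exact ⟨fun h i hi => h ⟨i, by lia⟩, fun h i => h i (by lia)⟩

theorem isLabelledInvolution_iff {n m : ℕ} {p : (Fin n → Fin m) × (Fin n → Fin n)}
    (hp : ∀ x, p.2 (p.2 x) = x) :
    IsLabelledInvolution p ↔ ∀ i (h : i + 1 < n), p.1 ⟨i, by lia⟩ < p.1 ⟨i + 1, h⟩ ∨
      p.1 ⟨i, by lia⟩ = p.1 ⟨i + 1, h⟩ ∧ p.2 ⟨i, by lia⟩ < p.2 ⟨i + 1, h⟩ := by
  have key : IsLabelledInvolution p ↔ StrictMono fun x => toLex (p.1 x, p.2 x) := by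
    simp only [StrictMono, Prod.Lex.toLex_lt_toLex]
    constructor
    · intro h x y hxy
      rcases (h.1 hxy.le).lt_or_eq with h' | h'
      · exact Or.inl h'
      · exact Or.inr ⟨h', h.2.2 x y hxy h'⟩
    · intro h
      refine ⟨fun x y hxy => ?_, hp, fun x y hxy h' => ?_⟩
      · rcases hxy.eq_or_lt with rfl | h'
        · rfl
        · rcases h h' with h'' | h''
          · exact h''.le
          · exact h''.1.le
      · rcases h hxy with h'' | h''
        · exact absurd h' h''.ne
        · exact h''.2
  rw [key, strictMono_fin_iff]
  simp only [Prod.Lex.toLex_lt_toLex]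

theorem mem_OmegaSet {n : ℕ} {a : ℤ} : a ∈ OmegaSet n ↔ 1 ≤ a.natAbs ∧ a.natAbs ≤ n := by
  simp only [OmegaSet, Set.mem_ofPred_eq, Int.abs_eq_natAbs]
  lia

theorem mem_OmegaSet_iff {n : ℕ} {a : ℤ} :
    a ∈ OmegaSet n ↔ ∃ x : Fin n, a = x + 1 ∨ a = -(x + 1) := by
  rw [mem_OmegaSet]
  constructor
  · rintro ⟨h1, h2⟩
    refine ⟨⟨a.natAbs - 1, by lia⟩, ?_⟩
    simp only
    lia
  · rintro ⟨⟨x, hx⟩, h | h⟩ <;> simp only at h <;> lia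

/-- The odd map sending `x` to `± v x`, with a minus sign when `ε x` holds, where `Fin n` is
identified with `{1, …, n}`. -/
noncomputable def signedMap {n : ℕ} (o : (Fin n → Fin n) × (Fin n → Bool)) (a : ℤ) : ℤ :=
  if h : 1 ≤ a.natAbs ∧ a.natAbs ≤ n then
    a.sign * (if o.2 ⟨a.natAbs - 1, by lia⟩ then -1 else 1) * (o.1 ⟨a.natAbs - 1, by lia⟩ + 1)
  else a

theorem signedMap_succ {n : ℕ} (o : (Fin n → Fin n) × (Fin n → Bool)) (x : Fin n) :
    signedMap o (x + 1) = (if o.2 x then -1 else 1) * (o.1 x + 1) := by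
  have h : 1 ≤ ((x : ℤ) + 1).natAbs ∧ ((x : ℤ) + 1).natAbs ≤ n := by have := x.2; lia
  have hx : (⟨((x : ℤ) + 1).natAbs - 1, by lia⟩ : Fin n) = x := Fin.ext (by simp only; lia)
  rw [signedMap, dif_pos h, hx, Int.sign_eq_one_of_pos (by lia), one_mul]

theorem signedMap_neg {n : ℕ} (o : (Fin n → Fin n) × (Fin n → Bool)) (a : ℤ) :
    signedMap o (-a) = -signedMap o a := by
  simp only [signedMap, Int.sign_neg, Int.natAbs_neg]
  split_ifs <;> ring

theorem signedMap_of_notMem {n : ℕ} (o : (Fin n → Fin n) × (Fin n → Bool)) {a : ℤ}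
    (ha : a ∉ OmegaSet n) : signedMap o a = a :=
  dif_neg (mem_OmegaSet.not.1 ha)

/-- Involutions of `Fin n` together with a set of signs that is constant on the orbits. -/
noncomputable def signedPairs (n : ℕ) : Finset ((Fin n → Fin n) × (Fin n → Bool)) :=
  {o | (∀ x, o.1 (o.1 x) = x) ∧ ∀ x, o.2 (o.1 x) = o.2 x}

theorem mem_signedPairs {n : ℕ} {o : (Fin n → Fin n) × (Fin n → Bool)} :
    o ∈ signedPairs n ↔ (∀ x, o.1 (o.1 x) = x) ∧ ∀ x, o.2 (o.1 x) = o.2 x := by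
  simp [signedPairs]

theorem isSignedInvolution_signedMap {n : ℕ} {o : (Fin n → Fin n) × (Fin n → Bool)}
    (ho : o ∈ signedPairs n) : IsSignedInvolution n (signedMap o) := by
  obtain ⟨ho1, ho2⟩ := mem_signedPairs.1 ho
  have hmaps : Set.MapsTo (signedMap o) (OmegaSet n) (OmegaSet n) := by
    intro a ha
    obtain ⟨x, rfl | rfl⟩ := mem_OmegaSet_iff.1 ha <;>
    · refine mem_OmegaSet_iff.2 ⟨o.1 x, ?_⟩
      simp only [signedMap_neg, signedMap_succ]
      split_ifs <;> lia
  have hinv : ∀ a, signedMap o (signedMap o a) = a := by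
    intro a
    by_cases ha : a ∈ OmegaSet n
    · obtain ⟨x, h⟩ := mem_OmegaSet_iff.1 ha
      have hx : signedMap o (signedMap o (x + 1)) = x + 1 := by
        rw [signedMap_succ]
        by_cases hε : o.2 x
        · rw [if_pos hε, neg_one_mul, signedMap_neg, signedMap_succ, ho1, ho2, if_pos hε]
          ring
        · rw [if_neg hε, one_mul, signedMap_succ, ho1, ho2, if_neg hε, one_mul]
      rcases h with rfl | rfl
      · exact hx
      · rw [signedMap_neg, signedMap_neg, hx]
    · rw [signedMap_of_notMem o ha, signedMap_of_notMem o ha]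
  exact ⟨⟨signedMap_neg o, Set.InvOn.bijOn ⟨fun a _ => hinv a, fun a _ => hinv a⟩ hmaps hmaps,
    fun a ha => signedMap_of_notMem o ha⟩, hinv⟩

theorem signedMap_injective {n : ℕ} :
    Function.Injective (signedMap : (Fin n → Fin n) × (Fin n → Bool) → ℤ → ℤ) := by
  intro o o' h
  have hx : ∀ x, o.1 x = o'.1 x ∧ o.2 x = o'.2 x := by
    intro x
    have hx := congrFun h (x + 1)
    rw [signedMap_succ, signedMap_succ] at hx
    rw [Fin.ext_iff]
    cases h1 : o.2 x <;> cases h2 : o'.2 x <;> simp [h1, h2] at hx ⊢ <;> lia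
  exact Prod.ext (funext fun x => (hx x).1) (funext fun x => (hx x).2)

theorem exists_signedMap_eq {n : ℕ} {w : ℤ → ℤ} (hw : IsSignedInvolution n w) :
    ∃ o ∈ signedPairs n, signedMap o = w := by
  obtain ⟨⟨hneg, hbij, hout⟩, hinv⟩ := hw
  have hpos : ∀ x : Fin n, ∃ y : Fin n, ∃ e : Bool,
      w (x + 1) = (if e then -1 else 1) * (y + 1) := by
    intro x
    obtain ⟨y, h | h⟩ := mem_OmegaSet_iff.1 (hbij.mapsTo (mem_OmegaSet_iff.2 ⟨x, Or.inl rfl⟩))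
    · exact ⟨y, false, by simp [h]⟩
    · exact ⟨y, true, by simp [h]⟩
  choose v ε hvε using hpos
  have heq : signedMap (v, ε) = w := by
    funext a
    by_cases ha : a ∈ OmegaSet n
    · obtain ⟨x, rfl | rfl⟩ := mem_OmegaSet_iff.1 ha
      · rw [signedMap_succ, hvε]
      · rw [signedMap_neg, signedMap_succ, hneg, hvε]
    · rw [signedMap_of_notMem _ ha, hout a ha]
  have hboth : ∀ x, v (v x) = x ∧ ε (v x) = ε x := by
    intro x
    have h := hinv (x + 1)
    rw [hvε] at h
    rw [Fin.ext_iff]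
    cases h1 : ε x <;> cases h2 : ε (v x) <;>
      simp only [h1, if_true, if_false, Bool.false_eq_true, one_mul, neg_one_mul, hneg, hvε, h2]
        at h ⊢ <;>
      lia
  exact ⟨(v, ε), mem_signedPairs.2 ⟨fun x => (hboth x).1, fun x => (hboth x).2⟩, heq⟩

theorem InkB_eq_card (n k : ℕ) : InkB n k = #{o ∈ signedPairs n | desB n (signedMap o) = k} := by
  rw [InkB, ← card_image_of_injective _ signedMap_injective, ← Set.ncard_coe_finset]
  congr 1
  ext w
  simp only [Set.mem_ofPred_eq, coe_image, coe_filter, Set.mem_image]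
  constructor
  · rintro ⟨hw, hk⟩
    obtain ⟨o, ho, rfl⟩ := exists_signedMap_eq hw
    exact ⟨o, ⟨ho, hk⟩, rfl⟩
  · rintro ⟨o, ⟨ho, hk⟩, rfl⟩
    exact ⟨isSignedInvolution_signedMap ho, hk⟩

/-- The descent predicate of `signedMap o`. -/
def IsDescent {n : ℕ} (o : (Fin n → Fin n) × (Fin n → Bool)) (i : ℕ) : Prop :=
  rlt (signedMap o ((i : ℤ) + 1)) (signedMap o (i : ℤ))

theorem isDescent_zero {n : ℕ} (o : (Fin n → Fin n) × (Fin n → Bool)) (h : 0 < n) :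
    IsDescent o 0 ↔ o.2 ⟨0, h⟩ := by
  have h0 : signedMap o ((0 : ℕ) : ℤ) = 0 := signedMap_of_notMem o (by simp [OmegaSet])
  have h1 := signedMap_succ o ⟨0, h⟩
  simp only at h1
  rw [IsDescent, h0, h1, rlt]
  cases o.2 ⟨0, h⟩ <;> simp <;> lia

theorem isDescent_succ {n i : ℕ} (o : (Fin n → Fin n) × (Fin n → Bool)) (h : i + 1 < n) :
    IsDescent o (i + 1) ↔
      (o.2 ⟨i + 1, h⟩ ∧ ¬ o.2 ⟨i, by lia⟩) ∨
        (o.2 ⟨i, by lia⟩ = o.2 ⟨i + 1, h⟩ ∧ o.1 ⟨i + 1, h⟩ < o.1 ⟨i, by lia⟩) := by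
  have h0 := signedMap_succ o ⟨i, by lia⟩
  have h1 := signedMap_succ o ⟨i + 1, h⟩
  simp only at h0 h1
  rw [IsDescent, h1, Nat.cast_succ, h0, rlt, Fin.lt_def]
  generalize (o.1 ⟨i, _⟩ : ℕ) = v1
  generalize (o.1 ⟨i + 1, _⟩ : ℕ) = v2
  cases o.2 ⟨i, by lia⟩ <;> cases o.2 ⟨i + 1, h⟩ <;> simp <;> lia

/-- Half of the labels, rounded up, as a sequence with initial value `0`. -/
def toChain {n m : ℕ} (κ : Fin n → Fin m) (j : ℕ) : ℕ :=
  if h : 1 ≤ j ∧ j ≤ n then ((κ ⟨j - 1, by lia⟩ : ℕ) + 1) / 2 else 0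

theorem toChain_succ {n m : ℕ} (κ : Fin n → Fin m) {i : ℕ} (h : i < n) :
    toChain κ (i + 1) = ((κ ⟨i, h⟩ : ℕ) + 1) / 2 := by
  simp [toChain, Nat.succ_le_of_lt h]

theorem toChain_zero {n m : ℕ} (κ : Fin n → Fin m) : toChain κ 0 = 0 := by
  simp [toChain]

theorem toChain_of_lt {n m : ℕ} (κ : Fin n → Fin m) {i : ℕ} (h : n < i) : toChain κ i = 0 := by
  simp [toChain, h]

theorem isLabelledInvolution_iff_toChain {n m : ℕ} {o : (Fin n → Fin n) × (Fin n → Bool)}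
    (ho : o ∈ signedPairs n) {κ : Fin n → Fin m} (hκ : ∀ x, (κ x : ℕ) % 2 = 1 ↔ o.2 x) :
    IsLabelledInvolution (κ, o.1) ↔
      ∀ i < n, toChain κ i + (if IsDescent o i then 1 else 0) ≤ toChain κ (i + 1) := by
  obtain ⟨ho1, -⟩ := mem_signedPairs.1 ho
  have hinj : Function.Injective o.1 := Function.Involutive.injective ho1
  have step : ∀ i (h : i + 1 < n), (κ ⟨i, by lia⟩ < κ ⟨i + 1, h⟩ ∨
      κ ⟨i, by lia⟩ = κ ⟨i + 1, h⟩ ∧ o.1 ⟨i, by lia⟩ < o.1 ⟨i + 1, h⟩) ↔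
      toChain κ (i + 1) + (if IsDescent o (i + 1) then 1 else 0) ≤ toChain κ (i + 1 + 1) := by
    intro i h
    have h1 := hκ ⟨i, by lia⟩
    have h2 := hκ ⟨i + 1, h⟩
    have h3 : o.1 ⟨i, by lia⟩ ≠ o.1 ⟨i + 1, h⟩ := fun h' => by simpa using hinj h'
    rw [toChain_succ κ (by lia), toChain_succ κ h, isDescent_succ o h]
    rw [Fin.lt_def, Fin.lt_def, Fin.lt_def, Fin.ext_iff]
    rw [Ne, Fin.ext_iff] at h3
    generalize o.2 ⟨i, _⟩ = e1 at *
    generalize o.2 ⟨i + 1, _⟩ = e2 at *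
    generalize (κ ⟨i, _⟩ : ℕ) = k1 at *
    generalize (κ ⟨i + 1, _⟩ : ℕ) = k2 at *
    generalize (o.1 ⟨i, _⟩ : ℕ) = v1 at *
    generalize (o.1 ⟨i + 1, _⟩ : ℕ) = v2 at *
    cases e1 <;> cases e2 <;> simp at h1 h2 ⊢ <;> (try split_ifs) <;> lia
  rw [isLabelledInvolution_iff ho1]
  constructor
  · rintro H (_ | i) hi
    · have h1 := hκ ⟨0, hi⟩
      rw [toChain_zero, toChain_succ κ hi, isDescent_zero o hi, ← h1]
      split_ifs <;> lia
    · exact (step i hi).1 (H i hi)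
  · exact fun H i hi => (step i hi).2 (H (i + 1) hi)

theorem pos_of_mem_chains {n r : ℕ} {o : (Fin n → Fin n) × (Fin n → Bool)} {s : ℕ → ℕ}
    (hs : s ∈ chains (IsDescent o) n r) {i : ℕ} (h : i < n) (ho : o.2 ⟨i, h⟩) :
    1 ≤ s (i + 1) := by
  have hs := (mem_chains.1 hs).2.1
  induction i with
  | zero => have := hs 0 h; rw [if_pos ((isDescent_zero o h).2 ho)] at this; lia
  | succ i ih =>
    have hi := hs (i + 1) h
    by_cases h' : o.2 ⟨i, by lia⟩
    · exact (ih _ h').trans (by lia)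
    · rw [if_pos ((isDescent_succ o h).2 (Or.inl ⟨ho, h'⟩))] at hi
      lia

theorem le_of_mem_chains {d : ℕ → Prop} {n r : ℕ} {s : ℕ → ℕ} (hs : s ∈ chains d n r) {i : ℕ}
    (h : i ≤ n) : s i ≤ r := by
  obtain ⟨-, h1, h2, -⟩ := mem_chains.1 hs
  induction h using Nat.decreasingInduction with
  | self => exact h2
  | of_succ k hk ih => exact le_trans (by have := h1 k hk; lia) ih

/-- The labels with given parities whose halves, rounded up, are given. -/
def ofChain {n : ℕ} (r : ℕ) (ε : Fin n → Bool) (s : ℕ → ℕ) (x : Fin n) : Fin (2 * r + 1) :=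
  ⟨min (2 * s (x + 1) - if ε x then 1 else 0) (2 * r), by lia⟩

theorem val_ofChain {n r : ℕ} {o : (Fin n → Fin n) × (Fin n → Bool)} {s : ℕ → ℕ}
    (hs : s ∈ chains (IsDescent o) n r) (x : Fin n) :
    (ofChain r o.2 s x : ℕ) + (if o.2 x then 1 else 0) = 2 * s (x + 1) := by
  have h1 := le_of_mem_chains hs (Nat.succ_le_of_lt x.2)
  have h2 := pos_of_mem_chains hs x.2
  simp only [ofChain, Nat.succ_eq_add_one, Fin.eta] at *
  split_ifs with h
  · have := h2 h
    lia
  · lia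

theorem toChain_ofChain {n r : ℕ} {o : (Fin n → Fin n) × (Fin n → Bool)} {s : ℕ → ℕ}
    (hs : s ∈ chains (IsDescent o) n r) : toChain (ofChain r o.2 s) = s := by
  obtain ⟨h0, -, -, h3⟩ := mem_chains.1 hs
  funext i
  rcases i with _ | i
  · rw [toChain_zero, h0]
  · by_cases hi : i < n
    · have := val_ofChain hs ⟨i, hi⟩
      rw [toChain_succ _ hi]
      split_ifs at this <;> simp only at this <;> lia
    · rw [toChain_of_lt _ (by lia), h3 _ (by lia)]

theorem card_labels_eq {n : ℕ} {o : (Fin n → Fin n) × (Fin n → Bool)} (ho : o ∈ signedPairs n)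
    (r : ℕ) :
    #{κ : Fin n → Fin (2 * r + 1) | (∀ x, (κ x : ℕ) % 2 = 1 ↔ o.2 x) ∧
      IsLabelledInvolution (κ, o.1)} = (n + r - desB n (signedMap o)).choose n := by
  have hd : desB n (signedMap o) = #{i ∈ range n | IsDescent o i} := rfl
  rw [hd, ← card_chains]
  refine card_nbij' toChain (ofChain r o.2) ?_ ?_ ?_ ?_
  · intro κ hκ
    obtain ⟨hκ1, hκ2⟩ : _ ∧ _ := by simpa using hκ
    refine mem_coe.2 (mem_chains.2 ⟨toChain_zero κ,
      (isLabelledInvolution_iff_toChain ho hκ1).1 hκ2, ?_, fun i hi => toChain_of_lt κ hi⟩)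
    rcases n with _ | n
    · rw [toChain_zero]
      lia
    · rw [toChain_succ κ (Nat.lt_succ_self n)]
      lia
  · intro s hs
    have hpar : ∀ x, (ofChain r o.2 s x : ℕ) % 2 = 1 ↔ o.2 x := fun x => by
      have := val_ofChain hs x
      split_ifs at this <;> lia
    simp only [coe_filter, mem_univ, true_and, Set.mem_ofPred_eq]
    refine ⟨hpar, (isLabelledInvolution_iff_toChain ho hpar).2 ?_⟩
    rw [toChain_ofChain hs]
    exact (mem_chains.1 hs).2.1
  · intro κ hκ
    obtain ⟨hκ1, hκ2⟩ : _ ∧ _ := by simpa using hκ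
    funext x
    have h1 := toChain_succ κ x.2
    have h2 := hκ1 x
    simp only [ofChain, h1, Fin.eta, Fin.ext_iff]
    split_ifs <;> lia
  · exact fun s hs => toChain_ofChain hs

theorem card_labelledInvolution_sameParity (n r : ℕ) :
    #{p : (Fin n → Fin (2 * r + 1)) × (Fin n → Fin n) | IsLabelledInvolution p ∧
      ∀ x, SameParity (p.1 x) (p.1 (p.2 x))} =
      ∑ o ∈ signedPairs n, (n + r - desB n (signedMap o)).choose n := by
  rw [card_eq_sum_card_fiberwise (t := signedPairs n)
    (f := fun p => (p.2, fun x => decide ((p.1 x : ℕ) % 2 = 1)))]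
  · refine sum_congr rfl fun o ho => ?_
    rw [← card_labels_eq ho]
    refine (card_nbij' (fun κ => (κ, o.1)) Prod.fst ?_ ?_ ?_ ?_).symm
    · intro κ hκ
      obtain ⟨hκ1, hκ2⟩ : _ ∧ _ := by simpa using hκ
      have ho2 := (mem_signedPairs.1 ho).2
      simp only [coe_filter, mem_filter, mem_univ, true_and, Set.mem_ofPred_eq, hκ2]
      refine ⟨fun x => ?_, Prod.ext rfl (funext fun x => ?_)⟩
      · have h1 := hκ1 x
        have h2 := hκ1 (o.1 x)
        rw [ho2] at h2
        rw [SameParity]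
        lia
      · simp [hκ1]
    · rintro ⟨κ, v⟩ hp
      simp only [coe_filter, mem_filter, mem_univ, true_and, Set.mem_ofPred_eq] at hp ⊢
      obtain ⟨⟨h1, -⟩, rfl⟩ := hp
      exact ⟨fun x => by simp, h1⟩
    · exact fun κ _ => rfl
    · rintro ⟨κ, v⟩ hp
      simp only [coe_filter, mem_filter, mem_univ, true_and, Set.mem_ofPred_eq] at hp
      exact Prod.ext rfl (congrArg Prod.fst hp.2).symm
  · intro p hp
    obtain ⟨h1, h2⟩ : _ ∧ _ := by simpa using hp
    refine mem_coe.2 (mem_signedPairs.2 ⟨h1.2.1, fun x => ?_⟩)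
    have := h2 x
    rw [SameParity] at this
    simp only [this]

theorem card_labelledInvolution_eq_sum_InkB (n r : ℕ) :
    #{p : (Fin n → Fin (2 * r + 1)) × (Fin n → Fin n) | IsLabelledInvolution p ∧
      ∀ x, SameParity (p.1 x) (p.1 (p.2 x))} =
      ∑ q ∈ antidiagonal r, InkB n q.1 * (n + q.2).choose n := by
  rw [card_labelledInvolution_sameParity]
  simp only [InkB_eq_card, card_filter, sum_mul]
  rw [sum_comm]
  refine sum_congr rfl fun o _ => ?_
  simp only [ite_mul, one_mul, zero_mul]
  have hdes : desB n (signedMap o) ≤ n := by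
    rw [desB]
    simpa using card_filter_le (range n) _
  by_cases h : desB n (signedMap o) ≤ r
  · rw [sum_eq_single (desB n (signedMap o), r - desB n (signedMap o)),
      if_pos rfl, Nat.add_sub_assoc h]
    · rintro ⟨a, b⟩ hq hne
      rw [HasAntidiagonal.mem_antidiagonal] at hq
      refine if_neg fun h' => hne (Prod.ext h'.symm ?_)
      simp only at hq h' ⊢
      lia
    · exact fun h' => absurd (HasAntidiagonal.mem_antidiagonal.2 (by simp only; lia)) h'
  · rw [Nat.choose_eq_zero_of_lt (by lia), sum_eq_zero]
    rintro ⟨a, b⟩ hq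
    rw [HasAntidiagonal.mem_antidiagonal] at hq
    exact if_neg fun h' => h (by simp only at hq h'; lia)

theorem choose_first_order (n k m : ℕ) :
    (2 * k + 1 : ℤ) * ((n + 1 + m).choose (n + 1) : ℤ) +
        (2 * (n + 1) - 2 * k - 1 : ℤ) * ((n + m).choose (n + 1) : ℤ) =
      (2 * (k + m) + 1 : ℤ) * ((n + m).choose n : ℤ) := by
  have h1 : ((n + 1 : ℕ) : ℤ) * ((n + 1 + m).choose (n + 1) : ℤ) =
      (n + 1 + m) * ((n + m).choose n : ℤ) := by
    have := Nat.add_one_mul_choose_eq (n + m) n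
    rw [show n + m + 1 = n + 1 + m by ring] at this
    zify at this
    push_cast
    linarith
  have h2 : ((n + 1 : ℕ) : ℤ) * ((n + m).choose (n + 1) : ℤ) = m * ((n + m).choose n : ℤ) := by
    have := Nat.choose_succ_right_eq (n + m) n
    rw [Nat.add_sub_cancel_left] at this
    zify at this
    push_cast
    linarith
  have h0 : ((n + 1 : ℕ) : ℤ) ≠ 0 := by positivity
  apply mul_left_cancel₀ h0
  push_cast at h1 h2 ⊢
  linear_combination (2 * k + 1 : ℤ) * h1 + (2 * (n + 1) - 2 * k - 1 : ℤ) * h2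

theorem choose_second_order (n k m : ℕ) :
    (n + 1 + 2 * k + 2 * k ^ 2 : ℤ) * ((n + 2 + m).choose (n + 2) : ℤ) +
        (4 * (n + 2) * (k + 1) - 2 * (n + 2) - 4 * (k + 1) ^ 2 + 2 : ℤ) *
          ((n + 1 + m).choose (n + 2) : ℤ) +
        (n + 1 + 2 * (n - k) + 2 * (n - k) ^ 2 : ℤ) * ((n + m).choose (n + 2) : ℤ) =
      (n + 1 + 2 * (k + m) + 2 * (k + m) ^ 2 : ℤ) * ((n + m).choose n : ℤ) := by
  have up (a b : ℕ) : ((b + 1 : ℕ) : ℤ) * ((a + 1).choose (b + 1) : ℤ) =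
      (a + 1) * (a.choose b : ℤ) := by
    have := Nat.add_one_mul_choose_eq a b
    zify at this
    push_cast
    linarith
  have across (b c : ℕ) : ((b + 1 : ℕ) : ℤ) * ((b + c).choose (b + 1) : ℤ) =
      c * ((b + c).choose b : ℤ) := by
    have := Nat.choose_succ_right_eq (b + c) b
    rw [Nat.add_sub_cancel_left] at this
    zify at this
    push_cast
    linarith
  have u1 := up (n + m) n
  have u2 := up (n + 1 + m) (n + 1)
  have a1 := across n m
  have a2 := across (n + 1) m
  have a3 : ((n + 2 : ℕ) : ℤ) * ((n + m).choose (n + 2) : ℤ) =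
      (m - 1) * ((n + m).choose (n + 1) : ℤ) := by
    rcases m with _ | m
    · simp [Nat.choose_eq_zero_of_lt]
    · have := across (n + 1) m
      rw [show n + 1 + m = n + (m + 1) by ring] at this
      push_cast at this ⊢
      linarith
  rw [show n + m + 1 = n + 1 + m by ring] at u1
  rw [show n + 1 + m + 1 = n + 2 + m by ring, show n + 1 + 1 = n + 2 by ring] at u2
  rw [show n + 1 + 1 = n + 2 by ring] at a2
  have h0 : ((n + 1 : ℕ) : ℤ) * ((n + 2 : ℕ) : ℤ) ≠ 0 := by positivity
  apply mul_left_cancel₀ h0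
  push_cast at *
  linear_combination
    (n + 1 + 2 * k + 2 * k ^ 2 : ℤ) * ((n + 1) * u2 + (n + 1 + m + 1) * u1) +
    (4 * (n + 2) * (k + 1) - 2 * (n + 2) - 4 * (k + 1) ^ 2 + 2 : ℤ) * ((n + 1) * a2 + m * u1) +
    (n + 1 + 2 * (n - k) + 2 * (n - k) ^ 2 : ℤ) * ((n + 1) * a3 + (m - 1) * a1)

theorem eq_of_sum_choose_eq {n : ℕ} {a b : ℕ → ℤ}
    (h : ∀ r, ∑ p ∈ antidiagonal r, a p.1 * ((n + p.2).choose n : ℤ) =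
      ∑ p ∈ antidiagonal r, b p.1 * ((n + p.2).choose n : ℤ)) : a = b := by
  funext k
  induction k using Nat.strong_induction_on with
  | _ k ih =>
    have hk := h k
    simp only [Nat.sum_antidiagonal_eq_sum_range_succ_mk, sum_range_succ] at hk
    rw [sum_congr rfl fun i hi => by rw [ih i (mem_range.1 hi)]] at hk
    simpa using hk

theorem sum_shift (f : ℤ → ℤ) (hf : f (-1) = 0) (n r : ℕ) :
    ∑ p ∈ antidiagonal r, f (p.1 - 1) * ((n + 1 + p.2).choose (n + 1) : ℤ) =
      ∑ p ∈ antidiagonal r, f p.1 * ((n + p.2).choose (n + 1) : ℤ) := by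
  rcases r with _ | r
  · simp [hf]
  · rw [Finset.Nat.sum_antidiagonal_succ, Finset.Nat.sum_antidiagonal_succ']
    simp [hf, add_assoc, add_comm 1]

theorem sum_shift_two (f : ℤ → ℤ) (hf : ∀ k < 0, f k = 0) (n r : ℕ) :
    ∑ p ∈ antidiagonal r, f (p.1 - 2) * ((n + 2 + p.2).choose (n + 2) : ℤ) =
      ∑ p ∈ antidiagonal r, f p.1 * ((n + p.2).choose (n + 2) : ℤ) := by
  rcases r with _ | _ | r
  · simp [hf, Nat.choose_eq_zero_of_lt]
  · simp [Finset.Nat.antidiagonal_succ, hf, Nat.choose_eq_zero_of_lt]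
  · rw [Finset.Nat.sum_antidiagonal_succ, Finset.Nat.sum_antidiagonal_succ,
      Finset.Nat.sum_antidiagonal_succ', Finset.Nat.sum_antidiagonal_succ']
    simp [hf, add_assoc, add_comm 2, Nat.choose_eq_zero_of_lt]

/-- The recurrence satisfied by the numbers of involutions in `B_n` with `k` descents. -/
def InvolutionRecurrence (I : ℕ → ℤ → ℤ) : Prop :=
  ∀ (n : ℕ) (k : ℤ), ((n : ℤ) + 2) * I (n + 2) k =
      (2 * k + 1) * I (n + 1) k + (2 * (n + 2 - k) + 1) * I (n + 1) (k - 1) +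
      ((n + 1 + 2 * k + 2 * k ^ 2) * I n k +
        (4 * (n + 2) * k - 2 * (n + 2) - 4 * k ^ 2 + 2) * I n (k - 1) +
        (n + 1 + 2 * (n + 2 - k) + 2 * (n + 2 - k) ^ 2) * I n (k - 2))

/-- The recurrence satisfied by sequences whose binomial transforms satisfy a two-term recurrence. -/
theorem recurrence_of_transform {I : ℕ → ℤ → ℤ} {N : ℕ → ℕ → ℤ}
    (hneg : ∀ n, ∀ k < 0, I n k = 0)
    (hN : ∀ n r, N n r = ∑ p ∈ antidiagonal r, I n p.1 * ((n + p.2).choose n : ℤ))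
    (hrec : ∀ n r : ℕ, ((n : ℤ) + 2) * N (n + 2) r =
      (2 * r + 1) * N (n + 1) r + (n + 1 + 2 * r + 2 * r ^ 2) * N n r) :
    InvolutionRecurrence I := by
  intro n k
  rcases lt_or_ge k 0 with hk | hk
  · simp [hneg, hk, show k - 1 < 0 by lia, show k - 2 < 0 by lia]
  lift k to ℕ using hk
  refine congrFun (eq_of_sum_choose_eq (n := n + 2)
    (a := fun k : ℕ => ((n : ℤ) + 2) * I (n + 2) k)
    (b := fun k : ℕ => (2 * (k : ℤ) + 1) * I (n + 1) k +
      (2 * (n + 2 - (k : ℤ)) + 1) * I (n + 1) (k - 1) +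
      ((n + 1 + 2 * (k : ℤ) + 2 * (k : ℤ) ^ 2) * I n k +
        (4 * (n + 2) * (k : ℤ) - 2 * (n + 2) - 4 * (k : ℤ) ^ 2 + 2) * I n (k - 1) +
        (n + 1 + 2 * (n + 2 - (k : ℤ)) + 2 * (n + 2 - (k : ℤ)) ^ 2) * I n (k - 2))) ?_) k
  intro r
  have h1 := sum_shift (fun k => (2 * (n + 2 - (k + 1)) + 1) * I (n + 1) k)
    (by simp [hneg]) (n + 1) r
  have h2 := sum_shift (fun k =>
    (4 * (n + 2) * (k + 1) - 2 * (n + 2) - 4 * (k + 1) ^ 2 + 2) * I n k) (by simp [hneg]) (n + 1) r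
  have h3 := sum_shift_two (fun k =>
    (n + 1 + 2 * (n + 2 - (k + 2)) + 2 * (n + 2 - (k + 2)) ^ 2) * I n k)
    (by simp +contextual [hneg]) n r
  simp only [sub_add_cancel, show n + 1 + 1 = n + 2 from rfl] at h1 h2 h3
  have e := hrec n r
  simp only [hN, mul_sum] at e
  simp only [add_mul _ _ (Nat.cast _), sum_add_distrib, h1, h2, h3]
  simp only [← sum_add_distrib]
  simp only [mul_assoc] at e ⊢
  rw [e, ← sum_add_distrib]
  refine sum_congr rfl fun p hp => ?_
  obtain rfl := mem_antidiagonal.1 hp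
  have c1 := choose_first_order (n + 1) p.1 p.2
  have c2 := choose_second_order n p.1 p.2
  rw [show n + 1 + 1 = n + 2 from rfl] at c1
  push_cast at c1 c2 ⊢
  linear_combination -I (n + 1) p.1 * c1 - I n p.1 * c2

theorem symm_of_recurrence {I : ℕ → ℤ → ℤ}
    (h0 : ∀ k, I 0 k = if k = 0 then 1 else 0)
    (h1 : ∀ k, I 1 k = if k = 0 ∨ k = 1 then 1 else 0)
    (hrec : InvolutionRecurrence I) (n : ℕ) :
    ∀ k, I n (n - k) = I n k := by
  induction n using Nat.strong_induction_on with
  | _ n ih =>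
    intro k
    match n with
    | 0 => simp [h0]
    | 1 =>
      rw [h1, h1]
      congr 1
      simp only [Nat.cast_one, eq_iff_iff]
      lia
    | n + 2 =>
      have e := hrec n (n + 2 - k)
      rw [show I (n + 1) (n + 2 - k) = I (n + 1) (k - 1) by
          rw [← ih (n + 1) (by lia)]; congr 1; push_cast; ring,
        show I (n + 1) (n + 2 - k - 1) = I (n + 1) k by
          rw [← ih (n + 1) (by lia)]; congr 1; push_cast; ring,
        show I n (n + 2 - k) = I n (k - 2) by rw [← ih n (by lia)]; congr 1; ring,
        show I n (n + 2 - k - 1) = I n (k - 1) by rw [← ih n (by lia)]; congr 1; ring,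
        show I n (n + 2 - k - 2) = I n k by rw [← ih n (by lia)]; congr 1; ring] at e
      apply mul_left_cancel₀ (show (n : ℤ) + 2 ≠ 0 by positivity)
      rw [hrec n k, show ((n + 2 : ℕ) : ℤ) - k = n + 2 - k by push_cast; ring, e]
      ring

/-- The linear combination of values of a symmetric sequence that is nonnegative as soon as the
sequence increases up to its middle. -/
theorem second_order_nonneg {f : ℤ → ℤ} {n : ℕ} (hneg : ∀ k < 0, f k = 0)
    (hpos : ∀ k, 0 ≤ f k) (hsymm : ∀ k, f (n - k) = f k)
    (hmono : ∀ k : ℤ, 2 * k ≤ n → f (k - 1) ≤ f k) {k : ℤ} (hk0 : 0 ≤ k) (hk : 2 * k ≤ n + 2) :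
    0 ≤ (n + 1 + 2 * k + 2 * k ^ 2) * f k +
        (4 * (n + 2) * k - 3 * (n + 2) - 6 * k ^ 2 + 2 * k + 3) * f (k - 1) +
        (2 * (n + 2) ^ 2 - 8 * (n + 2) * k + 9 * (n + 2) + 6 * k ^ 2 - 10 * k + 1) * f (k - 2) +
        (-2 * (n + 2) ^ 2 + 4 * (n + 2) * k - 7 * (n + 2) - 2 * k ^ 2 + 6 * k - 3) * f (k - 3) := by
  have hn : (0 : ℤ) ≤ n := by positivity
  rcases hk0.eq_or_lt with rfl | hk1
  · have := hpos 0
    simp [hneg]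
    positivity
  have d2 : 0 ≤ f (k - 1) - f (k - 2) := by
    have := hmono (k - 1) (by lia)
    rw [show k - 1 - 1 = k - 2 by ring] at this
    linarith
  have d3 : 0 ≤ f (k - 2) - f (k - 3) := by
    have := hmono (k - 2) (by lia)
    rw [show k - 2 - 1 = k - 3 by ring] at this
    linarith
  have c0 : 0 ≤ n + 1 + 2 * k + 2 * k ^ 2 := by positivity
  have c1 : 0 ≤ 2 * (2 * k - 1) * ((n : ℤ) + 2 - k) + 2 * k + 2 := by
    nlinarith
  have c2 : 0 ≤ 2 * ((n : ℤ) + 2 - k) ^ 2 + 7 * (n + 2) - 6 * k + 3 := by nlinarith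
  rcases lt_or_ge (n + 1 : ℤ) (2 * k) with h | h
  · have hk2 : (n : ℤ) = 2 * k - 2 := by lia
    have s := hsymm k
    rw [hk2, show 2 * k - 2 - k = k - 2 by ring] at s
    rw [← s, hk2]
    have c1 : 0 ≤ 2 * k ^ 2 - 4 * k + 3 := by nlinarith [sq_nonneg (k - 1)]
    rw [hk2] at c2
    have := mul_nonneg c1 d2
    have := mul_nonneg c2 d3
    nlinarith
  · have d1 : 0 ≤ f k - f (k - 1) := by
      rcases lt_or_ge (n : ℤ) (2 * k) with h' | h'
      · have s := hsymm k
        rw [show (n : ℤ) - k = k - 1 by lia] at s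
        simp [s]
      · linarith [hmono k h']
    have := mul_nonneg c0 d1
    have := mul_nonneg c1 d2
    have := mul_nonneg c2 d3
    nlinarith

theorem mono_of_recurrence {I : ℕ → ℤ → ℤ}
    (hneg : ∀ n, ∀ k < 0, I n k = 0) (hpos : ∀ n k, 0 ≤ I n k)
    (h1 : ∀ k, I 1 k = if k = 0 ∨ k = 1 then 1 else 0)
    (hsymm : ∀ (n : ℕ) k, I n (n - k) = I n k)
    (hrec : InvolutionRecurrence I) (n : ℕ) :
    ∀ k : ℤ, 2 * k ≤ n → I n (k - 1) ≤ I n k := by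
  induction n using Nat.strong_induction_on with
  | _ n ih =>
    intro k hk
    rcases le_or_gt k 0 with hk0 | hk0
    · rw [hneg n _ (by lia)]
      exact hpos n k
    match n with
    | 0 => lia
    | 1 => simp [h1]; lia
    | n + 2 =>
      push_cast at hk
      have e := hrec n k
      have e' := hrec n (k - 1)
      rw [show k - 1 - 1 = k - 2 by ring, show k - 1 - 2 = k - 3 by ring] at e'
      have s := second_order_nonneg (hneg n) (hpos n) (hsymm n) (ih n (by lia)) hk0.le hk
      have d2 : 0 ≤ I (n + 1) (k - 1) - I (n + 1) (k - 2) := by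
        have := ih (n + 1) (by lia) (k - 1) (by push_cast; lia)
        rw [show k - 1 - 1 = k - 2 by ring] at this
        linarith
      have d1 : 0 ≤ I (n + 1) k - I (n + 1) (k - 1) := by
        rcases lt_or_ge ((n + 1 : ℕ) : ℤ) (2 * k) with h' | h'
        · have s := hsymm (n + 1) k
          rw [show ((n + 1 : ℕ) : ℤ) - k = k - 1 by push_cast at *; lia] at s
          simp [s]
        · linarith [ih (n + 1) (by lia) k h']
      have p1 := mul_nonneg (show 0 ≤ 2 * k + 1 by lia) d1
      have p2 := mul_nonneg (show 0 ≤ 2 * ((n : ℤ) + 2) - 2 * k + 3 by lia) d2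
      have : 0 ≤ ((n : ℤ) + 2) * (I (n + 2) k - I (n + 2) (k - 1)) := by
        rw [mul_sub, e, e']
        linarith
      have := nonneg_of_mul_nonneg_right this (by positivity)
      linarith

/-- The number of labelled involutions with `2 * r + 1` labels such that the labels of a point and
of its partner always have the same parity. -/
noncomputable def sameParityCount (n r : ℕ) : ℤ :=
  #{p : (Fin n → Fin (2 * r + 1)) × (Fin n → Fin n) | IsLabelledInvolution p ∧
    ∀ x, SameParity (p.1 x) (p.1 (p.2 x))}

open PowerSeries in
theorem exists_series_sameParityCount (r : ℕ) :
    ∃ F : PowerSeries ℤ, F * ((1 - X) ^ (2 * r + 1) * (1 - X ^ 2) ^ (r ^ 2)) = 1 ∧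
      ∀ n, coeff n F = sameParityCount n r := by
  obtain ⟨F, hF, hcoeff⟩ := exists_series_card
    (upperPositions (SameParity (m := 2 * r + 1))) fun a => a.1 = a.2
  refine ⟨F, ?_, fun n => ?_⟩
  · rw [← card_diag_upperPositions, ← card_offDiag_upperPositions]
    convert hF
  · rw [hcoeff, sameParityCount, card_labelledInvolution,
      card_symmetric_eq n fun _ _ h => h.symm]
    congr!

theorem sameParityCount_zero (r : ℕ) : sameParityCount 0 r = 1 := by
  obtain ⟨F, hF, hcoeff⟩ := exists_series_sameParityCount r
  rw [← hcoeff, (coeff_one_of_mul_eq_one hF).1]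

theorem sameParityCount_one (r : ℕ) : sameParityCount 1 r = 2 * r + 1 := by
  obtain ⟨F, hF, hcoeff⟩ := exists_series_sameParityCount r
  rw [← hcoeff, (coeff_one_of_mul_eq_one hF).2]
  push_cast
  rfl

theorem sameParityCount_add_two (n r : ℕ) :
    ((n : ℤ) + 2) * sameParityCount (n + 2) r =
      (2 * r + 1) * sameParityCount (n + 1) r +
        (n + 1 + 2 * r + 2 * r ^ 2) * sameParityCount n r := by
  obtain ⟨F, hF, hcoeff⟩ := exists_series_sameParityCount r
  have := coeff_recurrence hF n
  rw [hcoeff, hcoeff, hcoeff] at this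
  rw [this]
  push_cast
  ring

theorem IZ_natCast (n k : ℕ) : IZ n k = InkB n k := by
  simp [IZ]

theorem IZ_of_neg (n : ℕ) {k : ℤ} (hk : k < 0) : IZ n k = 0 := if_neg (by lia)

theorem IZ_nonneg (n : ℕ) (k : ℤ) : 0 ≤ IZ n k := by
  rw [IZ]
  split_ifs <;> lia

theorem sameParityCount_eq_sum (n r : ℕ) :
    sameParityCount n r = ∑ p ∈ antidiagonal r, IZ n p.1 * ((n + p.2).choose n : ℤ) := by
  rw [sameParityCount, card_labelledInvolution_eq_sum_InkB]
  push_cast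
  simp only [IZ_natCast]

theorem IZ_eq_of_sum {n : ℕ} {b : ℤ → ℤ} (hneg : ∀ k < 0, b k = 0)
    (h : ∀ r, sameParityCount n r = ∑ p ∈ antidiagonal r, b p.1 * ((n + p.2).choose n : ℤ))
    (k : ℤ) : IZ n k = b k := by
  rcases lt_or_ge k 0 with hk | hk
  · rw [IZ_of_neg n hk, hneg k hk]
  · lift k to ℕ using hk
    exact congrFun (eq_of_sum_choose_eq (a := fun k : ℕ => IZ n k) (b := fun k : ℕ => b k)
      fun r => by rw [← sameParityCount_eq_sum, h]) k

theorem IZ_zero (k : ℤ) : IZ 0 k = if k = 0 then 1 else 0 := by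
  refine IZ_eq_of_sum (b := fun k => if k = 0 then 1 else 0) (fun k hk => if_neg (by lia))
    (fun r => ?_) k
  rw [sameParityCount_zero, Nat.sum_antidiagonal_eq_sum_range_succ_mk, sum_range_succ',
    sum_eq_zero fun i _ => by rw [if_neg (by lia), zero_mul]]
  simp

theorem IZ_one (k : ℤ) : IZ 1 k = if k = 0 ∨ k = 1 then 1 else 0 := by
  refine IZ_eq_of_sum (b := fun k => if k = 0 ∨ k = 1 then 1 else 0)
    (fun k hk => if_neg (by lia)) (fun r => ?_) k
  rw [sameParityCount_one, Nat.sum_antidiagonal_eq_sum_range_succ_mk, sum_range_succ']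
  rcases r with _ | r
  · simp
  · rw [sum_range_succ', sum_eq_zero]
    · simp
      ring
    · intro i _
      rw [if_neg (by lia), zero_mul]

end

/-- Inequality (16) in the proof of Theorem 4.2: for every `n ≥ 3` and `0 ≤ k ≤ ⌊n/2⌋`,
`D_0·I_{n-2,k}^B + D_1·I_{n-2,k-1}^B + D_2·I_{n-2,k-2}^B + D_3·I_{n-2,k-3}^B ≥ 0`, where
`D_0 = n + 2k² + 2k - 1`, `D_1 = 4nk - 3n - 6k² + 2k + 3`,
`D_2 = 2n² - 8nk + 9n + 6k² - 10k + 1`, `D_3 = -2n² + 4nk - 7n - 2k² + 6k - 3`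
(with `I_{m,j}^B = 0` for `j < 0`). -/
theorem InkB_ineq_16 (n : ℕ) (hn : 3 ≤ n) (k : ℤ) (hk0 : 0 ≤ k) (hk : k ≤ ((n / 2 : ℕ) : ℤ)) :
    0 ≤ ((n : ℤ) + 2 * k ^ 2 + 2 * k - 1) * IZ (n - 2) k +
        (4 * (n : ℤ) * k - 3 * (n : ℤ) - 6 * k ^ 2 + 2 * k + 3) * IZ (n - 2) (k - 1) +
        (2 * (n : ℤ) ^ 2 - 8 * (n : ℤ) * k + 9 * (n : ℤ) + 6 * k ^ 2 - 10 * k + 1) *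
          IZ (n - 2) (k - 2) +
        (-2 * (n : ℤ) ^ 2 + 4 * (n : ℤ) * k - 7 * (n : ℤ) - 2 * k ^ 2 + 6 * k - 3) *
          IZ (n - 2) (k - 3) := by
  obtain ⟨m, rfl⟩ : ∃ m, n = m + 2 := ⟨n - 2, by lia⟩
  have hneg : ∀ n, ∀ k < 0, IZ n k = 0 := fun n _ hk => IZ_of_neg n hk
  have hrec : InvolutionRecurrence IZ :=
    recurrence_of_transform hneg sameParityCount_eq_sum sameParityCount_add_two
  have hsymm := symm_of_recurrence IZ_zero IZ_one hrec
  have hmono := mono_of_recurrence hneg IZ_nonneg IZ_one hsymm hrec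
  have h := second_order_nonneg (hneg m) (IZ_nonneg m) (hsymm m) (hmono m) hk0 (by lia)
  rw [Nat.add_sub_cancel]
  push_cast
  convert h using 4
  ring
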